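/- arXiv:1809.04367 — 2 statements merged into one kernel-verified Lean document; each statement's English description precedes it below -/
import Mathlib

section
/- Fix α > 0. There exists a constant c > 0 such that for all n ∈ ℕ (n ≥ 1), all (x,y) ∈ V and all t ≥ 0: ∫₀^{tn²} (e^{s𝐁_n} 𝟙_{D∖{(0,1)}})((x,y)) ds ≤ c n √t; that is, the expected local time in D∖{(0,1)} up to time tn² of the continuous-time random walk generated by 𝐁_n started at (x,y) is at most c n √t. -/
open MeasureTheory Filter
open scoped BoundedContinuousFunction NNReal

/-- `p` lies in `V = {(x,y) : y ≥ x+1}`. -/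
def inV (p : ℤ × ℤ) : Prop := p.1 + 1 ≤ p.2

/-- `p` lies in the set `U` of vertices attached to the slow edges. -/
def inU (p : ℤ × ℤ) : Prop :=
  inV p ∧ (((p.1 = 0 ∨ p.1 = 1) ∧ 2 ≤ p.2) ∨ (p.1 ≤ -1 ∧ (p.2 = 0 ∨ p.2 = 1)))

/-- The `L¹` distance on `ℤ²`. -/
def dist1 (u v : ℤ × ℤ) : ℤ := |u.1 - v.1| + |u.2 - v.2|

/-- The pair `(u,v)` is a slow edge, i.e. belongs to `𝒰`. -/
def slowPair (u v : ℤ × ℤ) : Prop :=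
  inU u ∧ inU v ∧ dist1 u v = 1 ∧
    ((|u.1 - v.1| = 1 ∧ 2 ≤ u.2 ∧ 2 ≤ v.2) ∨ (|u.2 - v.2| = 1 ∧ u.1 ≤ -1 ∧ v.1 ≤ -1))

open Classical in
/-- The jump rates `c_n(u,v)` of the two-dimensional random walk on `V`:
`α/n` along slow edges, `1` along other nearest-neighbour edges, `0` otherwise. -/
noncomputable def cRate (α : ℝ) (n : ℕ) (u v : ℤ × ℤ) : ℝ :=
  if slowPair u v then α / n else if dist1 u v = 1 then 1 else 0

/-- The set `V = {(x,y) ∈ ℤ² : y ≥ x+1}` as a type. -/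
abbrev Vslice : Type := {p : ℤ × ℤ // p.1 + 1 ≤ p.2}

/-- The operator exponential `e^{tA}` of a bounded operator `A`, applied to `f`:
`e^{tA} f = ∑_k (t^k / k!) A^k f`. -/
noncomputable def expApply {E : Type*} [NormedAddCommGroup E] [NormedSpace ℝ E]
    (A : E →L[ℝ] E) (t : ℝ) (f : E) : E :=
  ∑' k : ℕ, (t ^ k / (k.factorial : ℝ)) • ((A ^ k) f)


/-! The comparison function `hfun` and its discrete Laplacian on `V`. -/

noncomputable def psi (e : ℝ) (k : ℤ) : ℝ := (1 - e) ^ k / e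

noncomputable def hfun (e : ℝ) (p : ℤ × ℤ) : ℝ :=
  if 1 ≤ p.1 then psi e (p.2 - p.1) + psi e (p.1 - 1)
  else if p.2 ≤ 0 then psi e (p.2 - p.1) + psi e (-p.2)
  else psi e (p.2 - 1) + psi e (-p.1)

lemma psi_succ (e : ℝ) (h0 : 0 < e) (h1 : e < 1) (k : ℤ) :
    psi e (k + 1) = psi e k - (1 - e) ^ k := by
  unfold psi
  rw [zpow_add_one₀ (by linarith)]
  field_simp

lemma psi_nonneg (e : ℝ) (h0 : 0 < e) (h1 : e < 1) (k : ℤ) : 0 ≤ psi e k := by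
  unfold psi
  have : (0 : ℝ) < 1 - e := by linarith
  positivity

lemma qpow_le_one (e : ℝ) (h0 : 0 < e) (h1 : e < 1) (k : ℤ) (hk : 0 ≤ k) :
    (1 - e) ^ k ≤ 1 := by
  lift k to ℕ using hk
  rw [zpow_natCast]
  exact pow_le_one₀ (by linarith) (by linarith)

lemma psi_le (e : ℝ) (h0 : 0 < e) (h1 : e < 1) (k : ℤ) (hk : 0 ≤ k) : psi e k ≤ 1 / e := by
  unfold psi
  have := qpow_le_one e h0 h1 k hk
  gcongr

lemma psi_lap (e : ℝ) (h0 : 0 < e) (h1 : e < 1) (k : ℤ) (hk : 1 ≤ k) :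
    psi e (k + 1) + psi e (k - 1) - 2 * psi e k ≤ e := by
  have a := psi_succ e h0 h1 k
  have b := psi_succ e h0 h1 (k - 1)
  have c := qpow_le_one e h0 h1 (k - 1) (by omega)
  have d : (1 - e) ^ k = (1 - e) ^ (k - 1) * (1 - e) := by
    rw [← zpow_add_one₀ (by linarith)]; congr 1; ring
  rw [sub_add_cancel] at b
  nlinarith

lemma psi_diff_le (e : ℝ) (h0 : 0 < e) (h1 : e < 1) (k : ℤ) (hk : 0 ≤ k) :
    psi e k - psi e (k + 1) ≤ 1 := by
  have a := psi_succ e h0 h1 k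
  have c := qpow_le_one e h0 h1 k (by omega)
  linarith

lemma psi_anti (e : ℝ) (h0 : 0 < e) (h1 : e < 1) (k : ℤ) :
    psi e (k + 1) ≤ psi e k := by
  have a := psi_succ e h0 h1 k
  have c : 0 < (1 - e) ^ k := zpow_pos (by linarith) k
  linarith

lemma psi_vals (e : ℝ) (h0 : 0 < e) (h1 : e < 1) :
    psi e 1 = psi e 0 - 1 ∧ psi e 2 = psi e 1 - (1 - e) := by
  have a := psi_succ e h0 h1 0
  have b := psi_succ e h0 h1 1
  norm_num at a b
  exact ⟨a, by linarith⟩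

lemma hfun_nonneg (e : ℝ) (h0 : 0 < e) (h1 : e < 1) (p : ℤ × ℤ) : 0 ≤ hfun e p := by
  unfold hfun
  have := psi_nonneg e h0 h1
  split_ifs <;> exact add_nonneg (this _) (this _)

lemma hfun_le (e : ℝ) (h0 : 0 < e) (h1 : e < 1) (p : ℤ × ℤ) (hp : p.1 + 1 ≤ p.2) :
    hfun e p ≤ 2 / e := by
  unfold hfun
  have := psi_le e h0 h1
  have h2 : 2 / e = 1 / e + 1 / e := by ring
  rw [h2]
  split_ifs <;> exact add_le_add (this _ (by omega)) (this _ (by omega))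

/-- Sum of `g` over the neighbours of `(x,y)` in `V`. -/
noncomputable def nbSum (x y : ℤ) (g : ℤ × ℤ → ℝ) : ℝ :=
  (if x + 2 ≤ y then g (x + 1, y) else 0) + g (x - 1, y) + g (x, y + 1)
    + (if x + 2 ≤ y then g (x, y - 1) else 0)

lemma hfun_C (e : ℝ) (x y : ℤ) (hx : 1 ≤ x) :
    hfun e (x, y) = psi e (y - x) + psi e (x - 1) := by
  simp [hfun, hx]

lemma hfun_C0 (e : ℝ) (y : ℤ) (hy : 1 ≤ y) :
    hfun e (0, y) = psi e (y - 1) + psi e 0 := by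
  have : ¬ y ≤ 0 := by omega
  simp [hfun, this]

lemma hfun_M (e : ℝ) (x y : ℤ) (hx : x ≤ 0) (hy : 1 ≤ y) :
    hfun e (x, y) = psi e (y - 1) + psi e (-x) := by
  have : ¬ y ≤ 0 := by omega
  have h2 : ¬ 1 ≤ x := by omega
  simp [hfun, this, h2]

lemma hfun_A (e : ℝ) (x y : ℤ) (hx : x + 1 ≤ y) (hy : y ≤ 0) :
    hfun e (x, y) = psi e (y - x) + psi e (-y) := by
  have h2 : ¬ 1 ≤ x := by omega
  simp [hfun, hy, h2]

/-- symmetry -/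
lemma hfun_symm (e : ℝ) (x y : ℤ) (hx : x + 1 ≤ y) :
    hfun e (1 - y, 1 - x) = hfun e (x, y) := by
  by_cases h1 : 1 ≤ x
  · rw [hfun_C e x y h1, hfun_A e _ _ (by omega) (by omega)]
    congr 2 <;> ring
  · by_cases h2 : y ≤ 0
    · rw [hfun_A e x y hx h2, hfun_C e _ _ (by omega)]
      congr 2 <;> ring
    · rw [hfun_M e x y (by omega) (by omega), hfun_M e _ _ (by omega) (by omega), add_comm]
      congr 2 <;> ring

lemma lap_C (e : ℝ) (h0 : 0 < e) (h1 : e ≤ 1 / 4) (x y : ℤ) (hx : 1 ≤ x) (hV : x + 1 ≤ y) :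
    nbSum x y (fun p => hfun e p - hfun e (x, y)) ≤
      3 * e - (1 / 2) * (if y = x + 1 ∧ (x, y) ≠ ((0 : ℤ), (1 : ℤ)) then 1 else 0) := by
  have h1' : e < 1 := by linarith
  obtain ⟨v1, v2⟩ := psi_vals e h0 h1'
  unfold nbSum
  beta_reduce
  by_cases hD : y = x + 1
  · subst hD
    have : (x, x + 1) ≠ ((0 : ℤ), (1 : ℤ)) := by simp; omega
    rw [if_neg (by omega), if_neg (by omega), if_pos ⟨rfl, this⟩]
    rw [hfun_C e x _ hx, hfun_C e x _ hx]
    rw [show x + 1 - x = 1 by ring, show x + 1 + 1 - x = 2 by ring]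
    by_cases hx1 : x = 1
    · subst hx1
      norm_num
      rw [hfun_C0 e 2 (by norm_num)]
      norm_num
      linarith
    · rw [hfun_C e (x - 1) _ (by omega)]
      have d := psi_diff_le e h0 h1' (x - 2) (by omega)
      rw [show x - 2 + 1 = x - 1 by ring] at d
      rw [show x + 1 - (x - 1) = 2 by ring, show x - 1 - 1 = x - 2 by ring]
      linarith
  · rw [if_pos (by omega), if_pos (by omega), if_neg (by tauto)]
    have L := psi_lap e h0 h1' (y - x) (by omega)
    rw [hfun_C e x _ hx, hfun_C e x _ hx, hfun_C e x _ hx, hfun_C e (x + 1) _ (by omega)]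
    rw [show y - (x + 1) = y - x - 1 by ring, show x + 1 - 1 = x by ring,
      show y + 1 - x = y - x + 1 by ring, show y - 1 - x = y - x - 1 by ring]
    by_cases hx1 : x = 1
    · subst hx1
      norm_num
      rw [hfun_C0 e y (by omega)]
      rw [sub_add_cancel] at L
      have d := psi_diff_le e h0 h1' (y - 1 - 1) (by omega)
      rw [show y - 1 - 1 + 1 = y - 1 by ring] at d
      linarith
    · rw [hfun_C e (x - 1) _ (by omega)]
      have d := psi_lap e h0 h1' (x - 1) (by omega)
      rw [show x - 1 + 1 = x by ring] at d
      rw [show y - (x - 1) = y - x + 1 by ring]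
      linarith

lemma lap_M (e : ℝ) (h0 : 0 < e) (h1 : e ≤ 1 / 4) (x y : ℤ) (hx : x ≤ 0) (hy : 1 ≤ y) :
    nbSum x y (fun p => hfun e p - hfun e (x, y)) ≤
      3 * e - (1 / 2) * (if y = x + 1 ∧ (x, y) ≠ ((0 : ℤ), (1 : ℤ)) then 1 else 0) := by
  have h1' : e < 1 := by linarith
  obtain ⟨v1, v2⟩ := psi_vals e h0 h1'
  unfold nbSum
  beta_reduce
  have hn : ¬ (y = x + 1 ∧ (x, y) ≠ ((0 : ℤ), (1 : ℤ))) := by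
    rintro ⟨a, b⟩
    apply b
    simp; omega
  rw [if_neg hn]
  -- vertical part
  have hvert : (hfun e (x, y + 1) - hfun e (x, y)) +
      (if x + 2 ≤ y then hfun e (x, y - 1) - hfun e (x, y) else 0) ≤ e := by
    rw [hfun_M e x (y + 1) hx (by omega), hfun_M e x y hx hy]
    rw [show y + 1 - 1 = y by ring]
    by_cases hy1 : y = 1
    · subst hy1
      split_ifs with hh
      · rw [hfun_A e x (1 - 1) (by omega) (by omega)]
        norm_num
        linarith
      · norm_num
        linarith
    · rw [if_pos (by omega), hfun_M e x (y - 1) hx (by omega)]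
      have L := psi_lap e h0 h1' (y - 1) (by omega)
      rw [show y - 1 + 1 = y by ring] at L
      linarith
  have hhor : (if x + 2 ≤ y then hfun e (x + 1, y) - hfun e (x, y) else 0) +
      (hfun e (x - 1, y) - hfun e (x, y)) ≤ e := by
    rw [hfun_M e (x - 1) y (by omega) hy, hfun_M e x y hx hy]
    rw [show -(x - 1) = -x + 1 by ring]
    by_cases hx1 : x = 0
    · subst hx1
      split_ifs with hh
      · rw [hfun_C e (0 + 1) y (by omega)]
        norm_num
        linarith
      · norm_num
        linarith
    · rw [if_pos (by omega), hfun_M e (x + 1) y (by omega) hy]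
      have L := psi_lap e h0 h1' (-x) (by omega)
      rw [show -(x + 1) = -x - 1 by ring]
      linarith
  linarith

lemma lap_le (e : ℝ) (h0 : 0 < e) (h1 : e ≤ 1 / 4) (x y : ℤ) (hV : x + 1 ≤ y) :
    nbSum x y (fun p => hfun e p - hfun e (x, y)) ≤
      3 * e - (1 / 2) * (if y = x + 1 ∧ (x, y) ≠ ((0 : ℤ), (1 : ℤ)) then 1 else 0) := by
  by_cases hx : 1 ≤ x
  · exact lap_C e h0 h1 x y hx hV
  by_cases hy : 1 ≤ y
  · exact lap_M e h0 h1 x y (by omega) hy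
  have key := lap_C e h0 h1 (1 - y) (1 - x) (by omega) (by omega)
  have e1 : nbSum (1 - y) (1 - x) (fun p => hfun e p - hfun e (1 - y, 1 - x)) =
      nbSum x y (fun p => hfun e p - hfun e (x, y)) := by
    unfold nbSum
    beta_reduce
    rw [hfun_symm e x y hV]
    have s1 := hfun_symm e (x - 1) y (by omega)
    have s2 := hfun_symm e x (y + 1) (by omega)
    rw [show 1 - (x - 1) = 1 - x + 1 by ring] at s1
    rw [show 1 - (y + 1) = 1 - y - 1 by ring] at s2
    rw [s1, s2]
    by_cases hh : x + 2 ≤ y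
    · have s3 := hfun_symm e (x + 1) y (by omega)
      have s4 := hfun_symm e x (y - 1) (by omega)
      rw [show 1 - (x + 1) = 1 - x - 1 by ring] at s3
      rw [show 1 - (y - 1) = 1 - y + 1 by ring] at s4
      rw [if_pos (by omega), if_pos (by omega), if_pos hh, if_pos hh, s3, s4]
      ring
    · rw [if_neg (by omega), if_neg (by omega), if_neg hh, if_neg hh]
      ring
  rw [e1] at key
  refine key.trans (le_of_eq ?_)
  congr 2
  refine if_congr ?_ rfl rfl
  simp only [ne_eq, Prod.mk.injEq]
  omega

/-- slow edges do not matter for `hfun` -/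
lemma hfun_slow (e : ℝ) (u v : ℤ × ℤ) (h : slowPair u v) : hfun e u = hfun e v := by
  obtain ⟨x, y⟩ := u
  obtain ⟨a, b⟩ := v
  obtain ⟨⟨h1, h2⟩, ⟨h3, h4⟩, h5, h6⟩ := h
  simp only [inV, dist1] at *
  have key0 : ∀ y : ℤ, 2 ≤ y → hfun e (0, y) = hfun e (1, y) := fun y hy => by
    rw [hfun_C0 e y (by omega), hfun_C e 1 y le_rfl]; norm_num
  have key1 : ∀ x : ℤ, x ≤ -1 → hfun e (x, 1) = hfun e (x, 0) := fun x hy => by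
    rw [hfun_M e x 1 (by omega) (by omega), hfun_A e x 0 (by omega) le_rfl]; norm_num [add_comm]
  rcases h6 with ⟨h7, h8, h9⟩ | ⟨h7, h8, h9⟩
  · have hb : b = y := by
      have : |y - b| = 0 := by omega
      rw [abs_eq_zero] at this; omega
    subst hb
    have : (x = 0 ∧ a = 1) ∨ (x = 1 ∧ a = 0) := by
      rcases h2 with ⟨q, _⟩ | _ <;> rcases h4 with ⟨r, _⟩ | _ <;>
        (try omega)
      rcases q with rfl | rfl <;> rcases r with rfl | rfl <;> simp at h7 ⊢
    rcases this with ⟨rfl, rfl⟩ | ⟨rfl, rfl⟩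
    · exact key0 _ h8
    · exact (key0 _ h8).symm
  · have hb : a = x := by
      have : |x - a| = 0 := by omega
      rw [abs_eq_zero] at this; omega
    subst hb
    have : (y = 0 ∧ b = 1) ∨ (y = 1 ∧ b = 0) := by
      rcases h2 with _ | ⟨_, q⟩ <;> rcases h4 with _ | ⟨_, r⟩ <;>
        (try omega)
      rcases q with rfl | rfl <;> rcases r with rfl | rfl <;> simp at h7 ⊢
    rcases this with ⟨rfl, rfl⟩ | ⟨rfl, rfl⟩
    · exact (key1 _ h8).symm
    · exact key1 _ h8

lemma dist1_cases (x y a b : ℤ) (h : dist1 (x, y) (a, b) = 1) :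
    (a, b) = (x + 1, y) ∨ (a, b) = (x - 1, y) ∨ (a, b) = (x, y + 1) ∨ (a, b) = (x, y - 1) := by
  simp only [dist1] at h
  simp only [Prod.mk.injEq]
  rcases abs_cases (x - a) with ⟨h1, _⟩ | ⟨h1, _⟩ <;>
    rcases abs_cases (y - b) with ⟨h2, _⟩ | ⟨h2, _⟩ <;> omega

lemma cRate_zero (α : ℝ) (n : ℕ) (u v : ℤ × ℤ) (h : dist1 u v ≠ 1) : cRate α n u v = 0 := by
  unfold cRate
  rw [if_neg (fun hs => h hs.2.2.1), if_neg h]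

lemma cRate_nonneg (α : ℝ) (hα : 0 < α) (n : ℕ) (u v : ℤ × ℤ) : 0 ≤ cRate α n u v := by
  unfold cRate
  split_ifs <;> positivity

lemma cRate_le (α : ℝ) (hα : 0 < α) (n : ℕ) (hn : 1 ≤ n) (u v : ℤ × ℤ) :
    cRate α n u v ≤ 1 + α := by
  unfold cRate
  have : α / n ≤ α := div_le_self hα.le (by exact_mod_cast hn)
  split_ifs <;> linarith

lemma tsum_nb (g : ℤ × ℤ → ℝ) (x y : ℤ) (hV : x + 1 ≤ y)
    (hg : ∀ v, dist1 (x, y) v ≠ 1 → g v = 0) :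
    ∑' v : Vslice, g v.1 = nbSum x y g := by
  have := tsum_subtype {p : ℤ × ℤ | p.1 + 1 ≤ p.2} g
  refine Eq.trans this ?_
  rw [tsum_eq_sum (s := {(x + 1, y), (x - 1, y), (x, y + 1), (x, y - 1)})]
  · rw [Finset.sum_insert, Finset.sum_insert, Finset.sum_insert, Finset.sum_singleton]
    · unfold nbSum
      have a1 : x - 1 + 1 ≤ y := by omega
      have a2 : x + 1 ≤ y + 1 := by omega
      have a3 : x + 1 + 1 ≤ y ↔ x + 2 ≤ y := by omega
      have a4 : x + 1 ≤ y - 1 ↔ x + 2 ≤ y := by omega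
      simp only [Set.indicator, Set.mem_ofPred_eq, a1, a2, a3, a4, if_true]
      ring
    all_goals simp
    all_goals omega
  · rintro ⟨a, b⟩ hb
    rw [Set.indicator_apply]
    split_ifs
    · apply hg
      intro hd
      have := dist1_cases x y a b hd
      simp at hb this
      omega
    · rfl

lemma B_lower (α : ℝ) (hα : 0 < α) (n : ℕ) (hn : 1 ≤ n) (f : Vslice → ℝ) (hf : ∀ v, 0 ≤ f v)
    (u : Vslice) :
    0 ≤ (∑' v : Vslice, cRate α n u.1 v.1 * (f v - f u)) + 4 * (1 + α) * f u := by
  classical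
  obtain ⟨⟨x, y⟩, hV⟩ := u
  set u : Vslice := ⟨(x, y), hV⟩ with hu
  let F : ℤ × ℤ → ℝ := fun p => if h : p.1 + 1 ≤ p.2 then f ⟨p, h⟩ else 0
  have hF0 : ∀ p, 0 ≤ F p := fun p => by
    simp only [F]; split_ifs
    · exact hf _
    · exact le_rfl
  have hF : ∀ v : Vslice, f v = F v.1 := fun v => by simp only [F]; rw [dif_pos v.2]
  have e1 : (∑' v : Vslice, cRate α n u.1 v.1 * (f v - f u)) =
      nbSum x y (fun p => cRate α n (x, y) p * (F p - f u)) := by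
    rw [← tsum_nb _ x y hV (fun v hv => by rw [cRate_zero _ _ _ _ hv, zero_mul])]
    refine tsum_congr fun v => ?_
    rw [← hF v]
  rw [e1]
  have key : ∀ p, -((1 + α) * f u) ≤ cRate α n (x, y) p * (F p - f u) := fun p => by
    have a := cRate_nonneg α hα n (x, y) p
    have b := cRate_le α hα n hn (x, y) p
    have c := mul_nonneg a (hF0 p)
    have d := mul_le_mul_of_nonneg_right b (hf u)
    linarith
  have hz : 0 ≤ (1 + α) * f u := mul_nonneg (by linarith) (hf u)
  unfold nbSum
  have k1 := key (x + 1, y)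
  have k2 := key (x - 1, y)
  have k3 := key (x, y + 1)
  have k4 := key (x, y - 1)
  split_ifs <;> linarith

lemma B_hfun (α : ℝ) (n : ℕ) (e : ℝ) (x y : ℤ) (hV : x + 1 ≤ y) :
    (∑' v : Vslice, cRate α n (x, y) v.1 * (hfun e v.1 - hfun e (x, y))) =
      nbSum x y (fun p => hfun e p - hfun e (x, y)) := by
  have e1 := tsum_nb (fun p => cRate α n (x, y) p * (hfun e p - hfun e (x, y))) x y hV
    (fun v hv => by rw [cRate_zero _ _ _ _ hv, zero_mul])
  refine e1.trans ?_
  have key : ∀ p, dist1 (x, y) p = 1 → cRate α n (x, y) p * (hfun e p - hfun e (x, y)) =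
      hfun e p - hfun e (x, y) := fun p hp => by
    unfold cRate
    by_cases hs : slowPair (x, y) p
    · rw [hfun_slow e _ _ hs]; simp
    · rw [if_neg hs, if_pos hp, one_mul]
  unfold nbSum
  beta_reduce
  rw [key (x + 1, y) (by simp [dist1]), key (x - 1, y) (by simp [dist1]),
    key (x, y + 1) (by simp [dist1]), key (x, y - 1) (by simp [dist1])]

/-! Semigroup facts. -/

/-- The semigroup generated by a bounded operator. -/
noncomputable def sg {E : Type*} [NormedAddCommGroup E] [NormedSpace ℝ E]
    (A : E →L[ℝ] E) (t : ℝ) : E →L[ℝ] E := NormedSpace.exp (t • A)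

lemma expApply_eq {E : Type*} [NormedAddCommGroup E] [NormedSpace ℝ E] [CompleteSpace E]
    (A : E →L[ℝ] E) (t : ℝ) (f : E) :
    HasSum (fun k : ℕ => (t ^ k / (k.factorial : ℝ)) • ((A ^ k) f))
      (sg A t f) := by
  have h := NormedSpace.exp_series_hasSum_exp' (𝕂 := ℝ) (t • A)
  have h2 := h.mapL (ContinuousLinearMap.apply ℝ E f)
  have e1 : (fun k : ℕ => (t ^ k / (k.factorial : ℝ)) • ((A ^ k) f)) =
      fun k : ℕ => ContinuousLinearMap.apply ℝ E f (((k.factorial : ℝ))⁻¹ • (t • A) ^ k) := by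
    funext k
    simp [smul_pow, smul_smul]
    ring_nf
  rw [e1]
  exact h2

lemma sg_zero {E : Type*} [NormedAddCommGroup E] [NormedSpace ℝ E]
    (A : E →L[ℝ] E) (f : E) : sg A 0 f = f := by
  simp [sg, NormedSpace.exp_zero]

lemma sg_deriv {E : Type*} [NormedAddCommGroup E] [NormedSpace ℝ E] [CompleteSpace E]
    (A : E →L[ℝ] E) (f : E) (s : ℝ) :
    HasDerivAt (fun s => sg A s f) (sg A s (A f)) s := by
  have h := hasDerivAt_exp_smul_const (𝕂 := ℝ) A s
  exact (ContinuousLinearMap.apply ℝ E f).hasFDerivAt.comp_hasDerivAt s h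

lemma sg_shift {E : Type*} [NormedAddCommGroup E] [NormedSpace ℝ E] [CompleteSpace E]
    (B : E →L[ℝ] E) (K t : ℝ) (f : E) :
    sg B t f = Real.exp (-(t * K)) • sg (B + K • 1) t f := by
  have e1 : t • B = t • (B + K • 1) + (-(t * K)) • (1 : E →L[ℝ] E) := by
    rw [smul_add, smul_smul, add_assoc, ← add_smul]; simp
  have e2 : NormedSpace.exp ((-(t * K)) • (1 : E →L[ℝ] E)) =
      (Real.exp (-(t * K))) • 1 := by
    have := (NormedSpace.algebraMap_exp_comm (𝕂 := ℝ)
      (𝔸 := E →L[ℝ] E) (-(t * K))).symm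
    rw [Algebra.algebraMap_eq_smul_one, Algebra.algebraMap_eq_smul_one,
      ← Real.exp_eq_exp_ℝ] at this
    exact this
  have hc : Commute (t • (B + K • 1)) ((-(t * K)) • (1 : E →L[ℝ] E)) :=
    (Commute.one_right _).smul_right _
  letI : NormedAlgebra ℚ (E →L[ℝ] E) := NormedAlgebra.restrictScalars ℚ ℝ (E →L[ℝ] E)
  unfold sg
  rw [e1, NormedSpace.exp_add_of_commute hc, e2]
  simp

lemma exp_nonneg_of_pos (A : (Vslice →ᵇ ℝ) →L[ℝ] (Vslice →ᵇ ℝ))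
    (hA : ∀ f : Vslice →ᵇ ℝ, (∀ v, 0 ≤ f v) → ∀ v, 0 ≤ A f v)
    (t : ℝ) (ht : 0 ≤ t) (f : Vslice →ᵇ ℝ) (hf : ∀ v, 0 ≤ f v) (u : Vslice) :
    0 ≤ sg A t f u := by
  have h := (expApply_eq A t f).mapL (BoundedContinuousFunction.evalCLM ℝ u)
  refine h.nonneg fun k => ?_
  have hk : ∀ k : ℕ, ∀ v, 0 ≤ (A ^ k) f v := by
    intro k
    induction k with
    | zero => simpa using hf
    | succ k ih =>
      rw [pow_succ']
      exact hA _ ih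
  have := hk k u
  simp only [BoundedContinuousFunction.evalCLM_apply, BoundedContinuousFunction.coe_smul,
    smul_eq_mul]
  positivity

lemma exp_nonneg_of_lower (B : (Vslice →ᵇ ℝ) →L[ℝ] (Vslice →ᵇ ℝ)) (K : ℝ)
    (hB : ∀ f : Vslice →ᵇ ℝ, (∀ v, 0 ≤ f v) → ∀ v, 0 ≤ B f v + K * f v)
    (t : ℝ) (ht : 0 ≤ t) (f : Vslice →ᵇ ℝ) (hf : ∀ v, 0 ≤ f v) (u : Vslice) :
    0 ≤ sg B t f u := by
  have h1 := exp_nonneg_of_pos (B + K • 1) (fun f hf v => by simpa using hB f hf v) t ht f hf u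
  rw [sg_shift B K]
  simp only [BoundedContinuousFunction.coe_smul, smul_eq_mul]
  have := Real.exp_pos (-(t * K))
  positivity

lemma exp_apply_ker (B : (Vslice →ᵇ ℝ) →L[ℝ] (Vslice →ᵇ ℝ)) (f : Vslice →ᵇ ℝ) (hf : B f = 0)
    (t : ℝ) : sg B t f = f := by
  have h := expApply_eq B t f
  have h2 : HasSum (fun k : ℕ => (t ^ k / (k.factorial : ℝ)) • ((B ^ k) f)) f := by
    have := hasSum_single (f := fun k : ℕ => (t ^ k / (k.factorial : ℝ)) • ((B ^ k) f)) 0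
      (fun k hk => by
        obtain ⟨j, rfl⟩ := Nat.exists_eq_succ_of_ne_zero hk
        simp [pow_succ, hf])
    simpa using this
  exact h.unique h2

/-- **Two-dimensional local time estimate on the diagonal** (Proposition 3.1, first part).
The expected local time in `D∖{(0,1)}` up to time `tn²` of the random walk generated by
`𝐁_n`, started anywhere in `V`, is at most `c n √t`. -/
theorem local_time_diagonal_dim_two (α : ℝ) (hα : 0 < α) :
    ∃ c : ℝ, 0 < c ∧ ∀ n : ℕ, 1 ≤ n →
      ∀ B : (Vslice →ᵇ ℝ) →L[ℝ] (Vslice →ᵇ ℝ),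
        (∀ f : Vslice →ᵇ ℝ, ∀ u : Vslice,
          B f u = ∑' v : Vslice, cRate α n u.1 v.1 * (f v - f u)) →
      ∀ χD : Vslice →ᵇ ℝ,
        (∀ u : Vslice,
          χD u = if u.1.2 = u.1.1 + 1 ∧ u.1 ≠ ((0 : ℤ), (1 : ℤ)) then 1 else 0) →
      ∀ u : Vslice, ∀ t : ℝ, 0 ≤ t →
        (∫ s in (0 : ℝ)..(t * (n : ℝ) ^ 2), expApply B s χD u) ≤ c * n * Real.sqrt t := by
  refine ⟨20, by norm_num, ?_⟩
  intro n hn B hB χ hχ u t ht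
  have hexp : ∀ s, expApply B s χ u = sg B s χ u := fun s => by
    rw [expApply, (expApply_eq B s χ).tsum_eq]
  simp only [hexp]
  set T : ℝ := t * (n : ℝ) ^ 2 with hT
  have hT0 : 0 ≤ T := by positivity
  have hsq : 20 * (n : ℝ) * Real.sqrt t = 20 * Real.sqrt T := by
    rw [hT, Real.sqrt_mul ht, Real.sqrt_sq (Nat.cast_nonneg n)]; ring
  rw [hsq]
  have hpos : ∀ s : ℝ, 0 ≤ s → ∀ f : Vslice →ᵇ ℝ, (∀ v, 0 ≤ f v) →
      0 ≤ sg B s f u := fun s hs f hf =>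
    exp_nonneg_of_lower B (4 * (1 + α)) (fun f hf v => by
      rw [hB]; exact B_lower α hα n hn f hf v) s hs f hf u
  have hder : ∀ f : Vslice →ᵇ ℝ, ∀ s : ℝ, HasDerivAt (fun s : ℝ => sg B s f u)
      (sg B s (B f) u) s := fun f s => by
    exact (BoundedContinuousFunction.evalCLM ℝ u).hasFDerivAt.comp_hasDerivAt s (sg_deriv B f s)
  have hcont : ∀ f : Vslice →ᵇ ℝ, Continuous (fun s : ℝ => sg B s f u) :=
    fun f => continuous_iff_continuousAt.2 fun s => (hder f s).continuousAt
  let one : Vslice →ᵇ ℝ := BoundedContinuousFunction.const _ 1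
  have hone : ∀ s : ℝ, sg B s one = one := fun s => by
    apply exp_apply_ker
    ext v
    rw [hB]
    simp [one]
  have hIntble : ∀ f : Vslice →ᵇ ℝ, IntervalIntegrable
      (fun s : ℝ => sg B s f u) volume 0 T :=
    fun f => (hcont f).intervalIntegrable _ _
  by_cases hT1 : T ≤ 1
  · have : (∫ s in (0 : ℝ)..T, sg B s χ u) ≤ ∫ s in (0 : ℝ)..T, (1 : ℝ) := by
      refine intervalIntegral.integral_mono_on hT0 (hIntble χ) (by simp) fun s hs => ?_
      have := hpos s hs.1 (one - χ) (fun v => by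
        simp only [one, BoundedContinuousFunction.coe_sub, Pi.sub_apply,
          BoundedContinuousFunction.const_apply, hχ]
        split_ifs <;> norm_num)
      rw [map_sub, hone] at this
      simpa [one] using this
    simp at this
    have h2 : T ≤ Real.sqrt T := Real.le_sqrt_of_sq_le (by nlinarith)
    have h3 := Real.sqrt_nonneg T
    linarith
  · push Not at hT1
    have hr : 1 ≤ Real.sqrt T := Real.one_le_sqrt.2 hT1.le
    have hr2 : Real.sqrt T * Real.sqrt T = T := Real.mul_self_sqrt hT0
    set r := Real.sqrt T
    set e : ℝ := 1 / (4 * r) with he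
    have he0 : 0 < e := by positivity
    have he1 : e ≤ 1 / 4 := by rw [he]; gcongr; linarith
    have he2 : e < 1 := by linarith
    let h : Vslice →ᵇ ℝ := BoundedContinuousFunction.ofNormedAddCommGroupDiscrete
      (fun v => hfun e v.1) (2 / e) (fun v => by
        rw [Real.norm_of_nonneg (hfun_nonneg e he0 he2 _)]
        exact hfun_le e he0 he2 _ v.2)
    have hh : ∀ v, h v = hfun e v.1 := fun v => rfl
    have hBh : ∀ v, B h v ≤ 3 * e - (1 / 2) * χ v := fun v => by
      obtain ⟨⟨x, y⟩, hV⟩ := v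
      rw [hB, hχ]
      simp only [hh]
      rw [B_hfun α n e x y hV]
      exact lap_le e he0 he1 x y hV
    have hle : ∀ s ∈ Set.Icc (0 : ℝ) T, sg B s χ u ≤
        6 * e - 2 * sg B s (B h) u := fun s hs => by
      have := hpos s hs.1 ((6 * e) • one - (2 : ℝ) • B h - χ) (fun v => by
        have := hBh v
        simp [one]
        linarith)
      rw [map_sub, map_sub, map_smul, map_smul, hone] at this
      simp [one] at this
      linarith
    have h1 : (∫ s in (0 : ℝ)..T, sg B s χ u) ≤
        ∫ s in (0 : ℝ)..T, (6 * e - 2 * sg B s (B h) u) :=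
      intervalIntegral.integral_mono_on hT0 (hIntble χ)
        ((by simp : IntervalIntegrable (fun _ : ℝ => 6 * e) volume 0 T).sub
          ((hIntble (B h)).const_mul 2)) hle
    have h2 : (∫ s in (0 : ℝ)..T, sg B s (B h) u) =
        sg B T h u - h u := by
      rw [intervalIntegral.integral_eq_sub_of_hasDerivAt (fun s _ => hder h s) (hIntble (B h))]
      rw [sg_zero]
    rw [intervalIntegral.integral_sub (by simp) ((hIntble (B h)).const_mul 2),
      intervalIntegral.integral_const, intervalIntegral.integral_const_mul, h2] at h1
    simp at h1
    have h3 := hpos T hT0 h (fun v => hfun_nonneg e he0 he2 _)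
    have h4 : h u ≤ 2 / e := hfun_le e he0 he2 _ u.2
    have h5 : 2 / e = 8 * r := by rw [he]; field_simp; norm_num
    have h6 : T * (6 * e) = 3 / 2 * r := by rw [← hr2, he]; field_simp; norm_num
    linarith
end

section
/- There exists a constant c > 0 such that for all t ≥ 0 and all z ∈ W: ∫₀ᵗ (e^{sL^△} 𝟙_{∂W})(z) ds ≤ c √t; that is, the expected local time in the boundary ∂W up to time t of the simple random walk on W reflected at its boundary, started at z, is at most c√t. -/
open MeasureTheory Filter
open scoped BoundedContinuousFunction NNReal

/-- The wedge `W = {(x,y) ∈ ℤ² : 0 ≤ x ≤ y}` as a type. -/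
abbrev Wslice : Type := {p : ℤ × ℤ // 0 ≤ p.1 ∧ p.1 ≤ p.2}

section aux

variable {E : Type*} [NormedAddCommGroup E] [NormedSpace ℝ E] [CompleteSpace E]

theorem aux_expApply_eq (A : E →L[ℝ] E) (t : ℝ) (f : E) :
    expApply A t f = NormedSpace.exp (t • A) f := by
  have h := NormedSpace.exp_series_hasSum_exp' (𝕂 := ℝ) (t • A)
  have h2 := h.mapL (ContinuousLinearMap.apply ℝ E f)
  rw [expApply]
  refine Eq.trans ?_ h2.tsum_eq
  refine tsum_congr fun k => ?_
  simp [smul_pow, smul_smul, div_eq_inv_mul]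

theorem aux_deriv (A : E →L[ℝ] E) (g : E) (s : ℝ) :
    HasDerivAt (fun s : ℝ => expApply A s g) (expApply A s (A g)) s := by
  have h := hasDerivAt_exp_smul_const (𝕂 := ℝ) A s
  have h2 := ((ContinuousLinearMap.apply ℝ E g).hasFDerivAt.comp_hasDerivAt s h)
  simp only [aux_expApply_eq]
  exact h2

theorem aux_cont (A : E →L[ℝ] E) (g : E) : Continuous (fun s : ℝ => expApply A s g) :=
  continuous_iff_continuousAt.2 fun s => (aux_deriv A g s).continuousAt

theorem aux_shift (A : E →L[ℝ] E) (s : ℝ) (f : E) :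
    expApply A s f = Real.exp (-(4 * s)) • expApply (A + (4 : ℝ) • 1) s f := by
  rw [aux_expApply_eq, aux_expApply_eq]
  have h : s • A = s • (A + (4 : ℝ) • 1) + algebraMap ℝ (E →L[ℝ] E) (-(4 * s)) := by
    rw [Algebra.algebraMap_eq_smul_one, smul_add, smul_smul, add_assoc, ← add_smul]
    rw [show s * 4 + -(4 * s) = 0 by ring]; simp
  let _ : NormedAlgebra ℚ (E →L[ℝ] E) := NormedAlgebra.restrictScalars ℚ ℝ _
  rw [h, NormedSpace.exp_add_of_commute (Algebra.commutes' _ _).symm,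
    ← NormedSpace.algebraMap_exp_comm, ← Real.exp_eq_exp_ℝ, Algebra.algebraMap_eq_smul_one]
  simp

theorem aux_smul_pow (B : E →L[ℝ] E) (s : ℝ) (k : ℕ) (f : E) :
    ((s • B) ^ k) f = s ^ k • (B ^ k) f := by
  rw [smul_pow]; rfl

end aux

theorem aux_nonneg (L : (Wslice →ᵇ ℝ) →L[ℝ] (Wslice →ᵇ ℝ))
    (hL : ∀ f : Wslice →ᵇ ℝ, (∀ u, 0 ≤ f u) → ∀ u, 0 ≤ L f u + 4 * f u)
    (f : Wslice →ᵇ ℝ) (hf : ∀ u, 0 ≤ f u) (s : ℝ) (hs : 0 ≤ s) (z : Wslice) :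
    0 ≤ expApply L s f z := by
  have hp : ∀ k : ℕ, ∀ u, 0 ≤ ((L + (4 : ℝ) • 1) ^ k) f u := by
    intro k
    induction k with
    | zero => simpa using hf
    | succ k ih =>
      intro u
      rw [pow_succ']
      have := hL _ ih u
      simpa using this
  rw [aux_shift]
  have h := NormedSpace.exp_series_hasSum_exp' (𝕂 := ℝ) (s • (L + (4 : ℝ) • 1))
  have h2 := h.mapL (ContinuousLinearMap.apply ℝ (Wslice →ᵇ ℝ) f)
  have h3 := h2.mapL (BoundedContinuousFunction.evalCLM ℝ z)
  have h4 : 0 ≤ expApply (L + (4 : ℝ) • 1) s f z := by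
    rw [aux_expApply_eq]
    refine HasSum.nonneg ?_ h3
    intro k
    have := hp k z
    have e : ((s • (L + (4 : ℝ) • 1)) ^ k) f = s ^ k • ((L + (4 : ℝ) • 1) ^ k) f := by
      exact aux_smul_pow _ _ _ _
    change 0 ≤ ((k.factorial : ℝ)⁻¹) * (((s • (L + (4 : ℝ) • 1)) ^ k) f z)
    rw [e]
    change 0 ≤ ((k.factorial : ℝ)⁻¹) * (s ^ k * (((L + (4 : ℝ) • 1) ^ k) f z))
    positivity
  exact mul_nonneg (Real.exp_pos _).le h4

open Classical in
/-- Contribution of a lattice point. -/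
noncomputable def auxG (F : Wslice → ℝ) (p : ℤ × ℤ) : ℝ :=
  if h : 0 ≤ p.1 ∧ p.1 ≤ p.2 then F ⟨p, h⟩ else 0

theorem aux_tsum (F : Wslice → ℝ) (x y : ℤ) (h : 0 ≤ x ∧ x ≤ y) :
    ∑' v : Wslice, (if dist1 (x, y) v.1 = 1 then (1 : ℝ) else 0) * F v =
      auxG F (x + 1, y) + auxG F (x - 1, y) + auxG F (x, y + 1) + auxG F (x, y - 1) := by
  have e1 : ∀ v : Wslice, (if dist1 (x, y) v.1 = 1 then (1 : ℝ) else 0) * F v =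
      (fun p : ℤ × ℤ => (if dist1 (x, y) p = 1 then (1 : ℝ) else 0) * auxG F p) v.1 := by
    rintro ⟨p, hp⟩
    simp [auxG, hp]
  rw [tsum_congr e1]
  have e2 := tsum_subtype {p : ℤ × ℤ | 0 ≤ p.1 ∧ p.1 ≤ p.2}
    (fun p : ℤ × ℤ => (if dist1 (x, y) p = 1 then (1 : ℝ) else 0) * auxG F p)
  refine e2.trans ?_
  have e3 : Set.indicator {p : ℤ × ℤ | 0 ≤ p.1 ∧ p.1 ≤ p.2}
    (fun p : ℤ × ℤ => (if dist1 (x, y) p = 1 then (1 : ℝ) else 0) * auxG F p) =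
    (fun p : ℤ × ℤ => (if dist1 (x, y) p = 1 then (1 : ℝ) else 0) * auxG F p) := by
    rw [Set.indicator_eq_self]
    intro p hp
    by_contra hc
    apply hp
    have : ¬ (0 ≤ p.1 ∧ p.1 ≤ p.2) := hc
    simp [auxG, this]
  rw [e3, tsum_eq_sum (s := {(x + 1, y), (x - 1, y), (x, y + 1), (x, y - 1)})]
  · rw [Finset.sum_insert, Finset.sum_insert, Finset.sum_insert, Finset.sum_singleton]
    · simp [dist1]; ring
    all_goals simp [Prod.ext_iff]
    all_goals omega
  · rintro ⟨a, b⟩ hab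
    rw [if_neg, zero_mul]
    intro hd
    apply hab
    simp only [dist1] at hd
    simp only [Finset.mem_insert, Finset.mem_singleton, Prod.mk.injEq]
    rcases abs_cases (x - a) with h1 | h1 <;> rcases abs_cases (y - b) with h2 | h2 <;> omega

/-- The geometric profile. -/
noncomputable def auxphi (q : ℝ) (n : ℤ) : ℝ := (1 - q ^ n.toNat) / (1 - q)

theorem auxphi_bd (q : ℝ) (h0 : 0 ≤ q) (h1 : q < 1) (n : ℤ) :
    0 ≤ auxphi q n ∧ auxphi q n ≤ 1 / (1 - q) := by
  have a := pow_le_one₀ h0 h1.le (n := n.toNat)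
  have b := pow_nonneg h0 n.toNat
  have c : 0 < 1 - q := by linarith
  constructor
  · exact div_nonneg (by linarith) c.le
  · unfold auxphi; gcongr; linarith

theorem auxphi_succ (q : ℝ) (h1 : q < 1) (n : ℤ) (hn : 0 ≤ n) :
    auxphi q (n + 1) = auxphi q n + q ^ n.toNat := by
  have c : 1 - q ≠ 0 := by linarith
  have : (n + 1).toNat = n.toNat + 1 := by omega
  unfold auxphi
  rw [this]; field_simp; ring

/-- Summary of differences at a positive integer. -/
theorem auxphi_diff (q : ℝ) (h0 : 0 ≤ q) (h1 : q < 1) (n : ℤ) (hn : 1 ≤ n) :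
    0 ≤ auxphi q (n + 1) - auxphi q n ∧ auxphi q n - auxphi q (n - 1) ≤ 1 ∧
    -(1 - q) ≤ auxphi q (n + 1) - auxphi q n + (auxphi q (n - 1) - auxphi q n) := by
  have a := auxphi_succ q h1 n (by omega)
  have b := auxphi_succ q h1 (n - 1) (by omega)
  rw [sub_add_cancel] at b
  have e : n.toNat = (n - 1).toNat + 1 := by omega
  rw [e, pow_succ] at a
  have p0 := pow_nonneg h0 (n - 1).toNat
  have p1 := pow_le_one₀ h0 h1.le (n := (n - 1).toNat)
  refine ⟨by rw [a]; nlinarith, by linarith, by rw [a]; nlinarith⟩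

theorem auxphi_zero (q : ℝ) (h1 : q < 1) : auxphi q 0 = 0 ∧ auxphi q 1 = 1 := by
  have c : 1 - q ≠ 0 := by linarith
  constructor
  · simp [auxphi]
  · simp [auxphi, c]

theorem aux_gen (q : ℝ) (h0 : 0 ≤ q) (h1 : q < 1) (x y : ℤ) (h : 0 ≤ x ∧ x ≤ y) :
    (if x = 0 ∨ x = y then (1 : ℝ) else 0) - 7 * (1 - q) ≤
    ∑' v : Wslice, (if dist1 (x, y) v.1 = 1 then (1 : ℝ) else 0) *
      ((3 * auxphi q v.1.1 + 2 * auxphi q (v.1.2 - v.1.1)) -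
        (3 * auxphi q x + 2 * auxphi q (y - x))) := by
  rw [aux_tsum (fun v : Wslice => (3 * auxphi q v.1.1 + 2 * auxphi q (v.1.2 - v.1.1)) -
        (3 * auxphi q x + 2 * auxphi q (y - x))) x y h]
  obtain ⟨hx, hxy⟩ := h
  obtain ⟨z0, z1⟩ := auxphi_zero q h1
  simp only [auxG]
  have s1 : y - (x + 1) = y - x - 1 := by ring
  have s2 : y - (x - 1) = y - x + 1 := by ring
  have s3 : y + 1 - x = y - x + 1 := by ring
  have s4 : y - 1 - x = y - x - 1 := by ring
  rw [s1, s2, s3, s4]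
  rcases eq_or_lt_of_le hx with hx0 | hx0
  · subst hx0
    rcases eq_or_lt_of_le hxy with hy | hy
    · subst hy
      simp [z0, z1]
      linarith
    · have d := auxphi_diff q h0 h1 y (by omega)
      rw [dif_pos (by constructor <;> omega), dif_neg (by omega),
        dif_pos (by constructor <;> omega), dif_pos (by constructor <;> omega)]
      simp [z0, z1]
      linarith
  · have c := auxphi_diff q h0 h1 x (by omega)
    rcases eq_or_lt_of_le hxy with hy | hy
    · subst hy
      rw [dif_neg (by omega), dif_pos (by constructor <;> omega),
        dif_pos (by constructor <;> omega), dif_neg (by omega)]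
      simp [z0, z1]
      linarith
    · have d := auxphi_diff q h0 h1 (y - x) (by omega)
      rw [dif_pos (by constructor <;> omega), dif_pos (by constructor <;> omega),
        dif_pos (by constructor <;> omega), dif_pos (by constructor <;> omega)]
      rw [if_neg (by omega)]
      linarith

theorem aux_pos (f : Wslice → ℝ) (hf : ∀ u, 0 ≤ f u) (u : Wslice) :
    0 ≤ ∑' v : Wslice, (if dist1 u.1 v.1 = 1 then (1 : ℝ) else 0) * (f v - f u) + 4 * f u := by
  have h : ∀ p, -f u ≤ auxG (fun v => f v - f u) p := by
    intro p
    unfold auxG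
    split_ifs with hp
    · linarith [hf ⟨p, hp⟩]
    · linarith [hf u]
  have e := aux_tsum (fun v => f v - f u) u.1.1 u.1.2 u.2
  simp only [Prod.mk.eta] at e
  rw [e]
  linarith [h (u.1.1 + 1, u.1.2), h (u.1.1 - 1, u.1.2), h (u.1.1, u.1.2 + 1), h (u.1.1, u.1.2 - 1)]

theorem aux_lin {L : (Wslice →ᵇ ℝ) →L[ℝ] (Wslice →ᵇ ℝ)} (s : ℝ) (f g : Wslice →ᵇ ℝ) (a : ℝ) :
    expApply L s (f + a • g) = expApply L s f + a • expApply L s g := by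
  simp [aux_expApply_eq]

/-- **Local time of the reflected walk on the boundary of the wedge** (Lemma 3.2). The
expected local time in `∂W = {x = 0 or x = y}` up to time `t` of the simple random walk
on `W` reflected at the boundary (each admissible jump at rate `1`) is at most `c√t`. -/
theorem local_time_boundary_reflected_wedge :
    ∃ c : ℝ, 0 < c ∧
      ∀ L : (Wslice →ᵇ ℝ) →L[ℝ] (Wslice →ᵇ ℝ),
        (∀ f : Wslice →ᵇ ℝ, ∀ u : Wslice,
          L f u = ∑' v : Wslice, (if dist1 u.1 v.1 = 1 then (1 : ℝ) else 0) * (f v - f u)) →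
      ∀ χ : Wslice →ᵇ ℝ,
        (∀ u : Wslice, χ u = if u.1.1 = 0 ∨ u.1.1 = u.1.2 then 1 else 0) →
      ∀ t : ℝ, 0 ≤ t → ∀ z : Wslice,
        (∫ s in (0 : ℝ)..t, expApply L s χ z) ≤ c * Real.sqrt t := by
  refine ⟨12, by norm_num, ?_⟩
  intro L hL χ hχ t ht z
  have hpos := aux_nonneg L (fun f hf u => by rw [hL]; exact aux_pos f hf u)
  -- monotonicity
  have hmono : ∀ f g : Wslice →ᵇ ℝ, (∀ u, f u ≤ g u) → ∀ s, 0 ≤ s → 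
      expApply L s f z ≤ expApply L s g z := by
    intro f g hfg s hs
    have h := hpos (g + (-1 : ℝ) • f) (fun u => by simpa using hfg u) s hs z
    rw [aux_lin] at h
    simpa using h
  let o : Wslice →ᵇ ℝ := BoundedContinuousFunction.const Wslice 1
  have hLo : L o = 0 := by
    ext u
    rw [hL]
    simp [o]
  have hone : ∀ s, expApply L s o = o := by
    intro s
    have hd : ∀ s, HasDerivAt (fun s : ℝ => expApply L s o) 0 s := by
      intro s
      have := aux_deriv L o s
      rw [hLo] at this
      simpa [aux_expApply_eq] using this
    have := is_const_of_deriv_eq_zero (fun s => (hd s).differentiableAt) (fun s => (hd s).deriv) s 0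
    rw [this]
    simp [aux_expApply_eq]
  have hcont : ∀ f : Wslice →ᵇ ℝ, Continuous fun s : ℝ => expApply L s f z := fun f =>
    (BoundedContinuousFunction.evalCLM ℝ z).continuous.comp (aux_cont L f)
  rcases lt_or_ge t 1 with ht1 | ht1
  · have h1 : (∫ s in (0 : ℝ)..t, expApply L s χ z) ≤ ∫ s in (0 : ℝ)..t, (1 : ℝ) := by
      apply intervalIntegral.integral_mono_on ht ((hcont χ).intervalIntegrable _ _) (by simp)
      intro s hs
      have := hmono χ o (fun u => by rw [hχ]; simp only [o, BoundedContinuousFunction.const_apply]; split_ifs <;> norm_num) s hs.1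
      rw [hone] at this
      simpa [o] using this
    have h2 : t ≤ Real.sqrt t := Real.le_sqrt_of_sq_le (by nlinarith)
    have := Real.sqrt_nonneg t
    simp at h1
    linarith
  · set r := Real.sqrt t with hr
    have hr1 : 1 ≤ r := Real.one_le_sqrt.2 ht1
    have hrr : r * r = t := Real.mul_self_sqrt ht
    obtain ⟨q, hq⟩ : ∃ q : ℝ, q = 1 - 1 / r := ⟨_, rfl⟩
    have hri : 1 / r ≤ 1 := by rw [div_le_one (by linarith)]; exact hr1
    have hri0 : 0 < 1 / r := by positivity
    have hq0 : 0 ≤ q := by linarith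
    have hq1 : q < 1 := by linarith
    have hqr : 1 / (1 - q) = r := by rw [hq]; simp
    have hb := auxphi_bd q hq0 hq1
    rw [hqr] at hb
    let g : Wslice →ᵇ ℝ := BoundedContinuousFunction.ofNormedAddCommGroupDiscrete
      (fun u : Wslice => 3 * auxphi q u.1.1 + 2 * auxphi q (u.1.2 - u.1.1)) (5 * r) (by
        intro u
        have h1 := hb u.1.1
        have h2 := hb (u.1.2 - u.1.1)
        rw [Real.norm_eq_abs, abs_le]
        constructor <;> linarith)
    have hg : ∀ u, g u = 3 * auxphi q u.1.1 + 2 * auxphi q (u.1.2 - u.1.1) := fun u => rfl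
    have hg0 : ∀ u, 0 ≤ g u := by
      intro u
      rw [hg]
      linarith [hb u.1.1, hb (u.1.2 - u.1.1)]
    have hg1 : ∀ u, g u ≤ 5 * r := by
      intro u
      rw [hg]
      linarith [hb u.1.1, hb (u.1.2 - u.1.1)]
    have hkey : ∀ u, χ u ≤ (L g + (7 / r) • o) u := by
      intro u
      have h := aux_gen q hq0 hq1 u.1.1 u.1.2 u.2
      simp only [Prod.mk.eta] at h
      have e : (L g + (7 / r) • o) u = L g u + 7 / r := by simp [o]
      rw [e, hL, hχ]
      simp only [hg]
      have e2 : 7 / r = 7 * (1 - q) := by rw [hq]; ring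
      rw [e2]
      linarith
    have h1 : (∫ s in (0 : ℝ)..t, expApply L s χ z) ≤
        ∫ s in (0 : ℝ)..t, (expApply L s (L g) z + 7 / r) := by
      apply intervalIntegral.integral_mono_on ht ((hcont χ).intervalIntegrable _ _)
        (((hcont (L g)).add continuous_const).intervalIntegrable _ _)
      intro s hs
      have := hmono χ _ hkey s hs.1
      rw [aux_lin, hone] at this
      simpa [o] using this
    have h2 : ∫ s in (0 : ℝ)..t, expApply L s (L g) z = expApply L t g z - expApply L 0 g z := by
      apply intervalIntegral.integral_eq_sub_of_hasDerivAt (f := fun s => expApply L s g z)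
      · intro s _
        exact (BoundedContinuousFunction.evalCLM ℝ z).hasFDerivAt.comp_hasDerivAt s (aux_deriv L g s)
      · exact (hcont (L g)).intervalIntegrable _ _
    rw [intervalIntegral.integral_add ((hcont (L g)).intervalIntegrable _ _) (by simp), h2] at h1
    have h3 : expApply L t g z ≤ 5 * r := by
      have := hmono g ((0 : Wslice →ᵇ ℝ) + (5 * r) • o) (fun u => by simpa [o] using hg1 u) t ht
      rw [aux_lin, hone] at this
      simpa [o, aux_expApply_eq] using this
    have h4 := hpos g hg0 0 le_rfl z
    have h5 : ∫ s in (0 : ℝ)..t, (7 / r) = 7 * r := by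
      rw [intervalIntegral.integral_const, ← hrr, smul_eq_mul]
      field_simp
      ring
    linarith
end
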